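/- arXiv:1402.6873 — 2 statements merged into one kernel-verified Lean document; each statement's English description precedes it below -/
import Mathlib

section
/- For any rational number s ∈ I_1(r;n) ∪ I_2(r;n), the cyclic word (u_s) does not contain a subword w of the cyclic word (u_r^n) or of (u_r^{−n}) such that w is a product of 4n−1 pieces but is not a product of fewer than 4n−1 pieces. -/
/- Formalization of statements from "Homotopically equivalent simple loops on
2-bridge spheres in Heckoid orbifolds for 2-bridge links (II)" by Lee-Sakuma.

We work in the free group `F` on two generators `a = gen 0`, `b = gen 1`.
For a rational `s` (in lowest terms `q/p`, with `0 ≤ s ≤ 1`), `uWord s` is the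
word `u_s = a b^{ε₁} a^{ε₂} ⋯ b^{ε_{2p-1}}` with `ε_i = (-1)^⌊i·s⌋`.
`CS s` is (a linear representative of) the cyclic sequence of lengths of
maximal constant-sign runs of exponents of `u_s`; since `u_s` begins with a
positive letter and (for `0 < s ≤ 1`) ends with a negative letter, the linear
run-length sequence represents the cyclic one.  `CyclicContains L T` says the
cyclic sequence represented by `L` contains `T` as a block of consecutive
terms.  `cfQ [m₁,…,m_k]` is the continued fraction `1/(m₁+1/(m₂+⋯+1/m_k))`.
`memI1 M n s` / `memI2 M n s` express `s ∈ I₁(r;n)` / `s ∈ I₂(r;n)` where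
`r = cfQ M`, and `memI1hat` / `memI2hat` express `s ∈ I₁(r)` / `s ∈ I₂(r)`.
The Heckoid group `Heck(r;n) = ⟨a,b | u_r^n⟩` is the quotient of `F` by the
normal closure `heckN r n` of `u_r^n`, with quotient map `heckQ r n`. -/

namespace Heckoid

abbrev F : Type := FreeGroup (Fin 2)

/-- The generators: `gen 0 = a`, `gen 1 = b` (and `gen i` depends on parity). -/
def gen (i : ℕ) : F := FreeGroup.of ⟨i % 2, Nat.mod_lt _ (by norm_num)⟩

/-- The word `u_s = a b^{ε₁} a^{ε₂} b^{ε₃} ⋯ a^{ε_{2p-2}} b^{ε_{2p-1}}`,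
where `s = q/p` in lowest terms and `ε_i = (-1)^⌊iq/p⌋`. -/
def uWord (s : ℚ) : F :=
  ((List.range (2 * s.den)).map
    (fun i => gen i ^ ((-1 : ℤ) ^ (⌊(i : ℚ) * s⌋.toNat)))).prod

/-- The sequence of exponent signs `ε₀, ε₁, …, ε_{2p-1}` of `u_s`. -/
def signList (s : ℚ) : List ℤ :=
  (List.range (2 * s.den)).map (fun i => (-1 : ℤ) ^ (⌊(i : ℚ) * s⌋.toNat))

/-- Lengths of the maximal runs of equal consecutive entries. -/
def runLengths {α : Type} [BEq α] (l : List α) : List ℕ :=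
  (l.splitBy (· == ·)).map List.length

/-- `CS s = CS(u_s)`: the cyclic sequence of lengths of maximal constant-sign
runs of `u_s`, represented by a list. -/
def CS (s : ℚ) : List ℕ := runLengths (signList s)

/-- The cyclic sequence represented by `L` contains `T` as a block of
consecutive terms. -/
def CyclicContains (L T : List ℕ) : Prop := ∃ k, T <+: L.rotate k

/-- The continued fraction `[m₁, m₂, …, m_k] = 1/(m₁+1/(m₂+⋯+1/m_k))`. -/
def cfQ : List ℕ → ℚ
  | [] => 0
  | a :: l => 1 / ((a : ℚ) + cfQ l)

/-- `d⟨T, T'⟩`: `d` consecutive repetitions of the concatenation of `T` and `T'`. -/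
def rep2 (d : ℕ) (T T' : List ℕ) : List ℕ := (List.replicate d (T ++ T')).flatten

/-- `s ∈ I₁(r;n)` where `r = cfQ M`:  `[0, [m₁,…,m_{k-1},m_k-1,2]]` for `k` even,
`[0, [m₁,…,m_k,2n-2])` for `k` odd. -/
def memI1 (M : List ℕ) (n : ℕ) (s : ℚ) : Prop :=
  if Even M.length then 0 ≤ s ∧ s ≤ cfQ (M.dropLast ++ [M.getLast! - 1, 2])
  else 0 ≤ s ∧ s < cfQ (M ++ [2 * n - 2])

/-- `s ∈ I₂(r;n)` where `r = cfQ M`: `([m₁,…,m_k,2n-2], 1]` for `k` even,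
`[[m₁,…,m_{k-1},m_k-1,2], 1]` for `k` odd. -/
def memI2 (M : List ℕ) (n : ℕ) (s : ℚ) : Prop :=
  if Even M.length then cfQ (M ++ [2 * n - 2]) < s ∧ s ≤ 1
  else cfQ (M.dropLast ++ [M.getLast! - 1, 2]) ≤ s ∧ s ≤ 1

/-- `s ∈ I₁(r)` where `r = cfQ M`. -/
def memI1hat (M : List ℕ) (s : ℚ) : Prop :=
  if Even M.length then 0 ≤ s ∧ s ≤ cfQ (M.dropLast ++ [M.getLast! - 1])
  else 0 ≤ s ∧ s ≤ cfQ M.dropLast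

/-- `s ∈ I₂(r)` where `r = cfQ M`. -/
def memI2hat (M : List ℕ) (s : ℚ) : Prop :=
  if Even M.length then cfQ M.dropLast ≤ s ∧ s ≤ 1
  else cfQ (M.dropLast ++ [M.getLast! - 1]) ≤ s ∧ s ≤ 1

/-- The symmetrized set `R`: all (cyclically reduced) cyclic permutations of
`u_r^n` and of `u_r^{-n}`. -/
def Rset (r : ℚ) (n : ℕ) : Set F :=
  {g | ∃ k, g = FreeGroup.mk ((uWord r ^ n).toWord.rotate k)} ∪
  {g | ∃ k, g = FreeGroup.mk (((uWord r ^ n)⁻¹).toWord.rotate k)}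

/-- A piece: a nonempty word occurring as an initial segment of two distinct
elements of the symmetrized set `R`. -/
def IsPiece (r : ℚ) (n : ℕ) (w : List (Fin 2 × Bool)) : Prop :=
  w ≠ [] ∧ ∃ g₁ ∈ Rset r n, ∃ g₂ ∈ Rset r n, g₁ ≠ g₂ ∧
    w <+: g₁.toWord ∧ w <+: g₂.toWord

/-- `w` is a product (concatenation) of `j` pieces. -/
def IsProdOfPieces (r : ℚ) (n j : ℕ) (w : List (Fin 2 × Bool)) : Prop :=
  ∃ ps : List (List (Fin 2 × Bool)),
    ps.length = j ∧ (∀ p ∈ ps, IsPiece r n p) ∧ ps.flatten = w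

/-! ### Words as windows of periodic letter sequences -/

/-- The `i`-th letter of the bi-infinite alternating word of slope `q / p` and height offset
`x / p`. -/
def letter (p : ℕ) (q x : ℤ) (i : ℕ) : Fin 2 × Bool :=
  (⟨i % 2, Nat.mod_lt _ (by norm_num)⟩, decide (Even ((x + i * q) / (p : ℤ))))

/-- The block of `L` consecutive letters starting at position `g`. -/
def window (p : ℕ) (q x : ℤ) (g L : ℕ) : List (Fin 2 × Bool) :=
  (List.range L).map fun j => letter p q x (g + j)

variable {p : ℕ} {q x y : ℤ} {g L : ℕ}

@[simp]
theorem length_window : (window p q x g L).length = L := by simp [window]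

theorem getElem_window (i : ℕ) (hi : i < (window p q x g L).length) :
    (window p q x g L)[i] = letter p q x (g + i) := by simp [window]

theorem window_append (a b : ℕ) :
    window p q x g (a + b) = window p q x g a ++ window p q x (g + a) b := by
  simp [window, List.range_add, Function.comp_def, add_assoc]

theorem window_prefix {N : ℕ} (hL : L ≤ N) : window p q x g L <+: window p q x g N := by
  obtain ⟨k, rfl⟩ := Nat.exists_eq_add_of_le hL
  rw [window_append]
  exact List.prefix_append _ _

theorem letter_congr {i k : ℕ} (hik : i % 2 = k % 2) (c : ℤ)
    (hc : (x + i * q) / (p : ℤ) = (y + k * q) / (p : ℤ) + 2 * c) :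
    letter p q x i = letter p q y k := by
  simp only [letter, hik, hc, Prod.mk.injEq, true_and, decide_eq_decide]
  simp [Int.even_add]

theorem letter_periodic (hp : 0 < p) (n : ℕ) :
    Function.Periodic (letter p q x) (2 * p * n) := by
  intro i
  refine letter_congr (by rw [mul_assoc]; omega) (n * q) ?_
  rw [show x + ((i + 2 * p * n : ℕ) : ℤ) * q = x + i * q + p * (2 * (n * q)) by push_cast; ring,
    Int.add_mul_ediv_left _ _ (by omega)]

theorem window_rotate (hp : 0 < p) (n k : ℕ) :
    (window p q x g (2 * p * n)).rotate k = window p q x (g + k) (2 * p * n) := by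
  refine List.ext_getElem (by simp) fun i h₁ h₂ => ?_
  rw [List.getElem_rotate, getElem_window, getElem_window, length_window]
  have hper := letter_periodic (q := q) (x := x) hp n
  have h3 := hper.const_add g
  simpa [add_assoc, add_comm k i] using h3.map_mod_nat (i + k)

theorem infix_window {w : List (Fin 2 × Bool)} (hw : w <:+: window p q x g L) :
    ∃ g', w.length ≤ L ∧ w = window p q x g' w.length := by
  obtain ⟨s, t, hst⟩ := hw
  have hlen := congrArg List.length hst
  simp only [List.length_append, length_window] at hlen
  rw [← hlen, window_append, window_append] at hst
  refine ⟨g + s.length, by omega, ?_⟩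
  have h1 := (List.append_inj hst (by simp)).1
  exact (List.append_inj h1 (by simp)).2

theorem isReduced_window : FreeGroup.IsReduced (window p q x g L) := by
  unfold FreeGroup.IsReduced
  rw [List.isChain_iff_getElem]
  intro i hi h
  simp only [getElem_window, letter, Fin.mk.injEq] at h
  omega

theorem toWord_mk_window : (FreeGroup.mk (window p q x g L)).toWord = window p q x g L := by
  rw [FreeGroup.toWord_mk, isReduced_window.reduce_eq]

theorem prod_mk_singleton {α : Type*} (l : List (α × Bool)) :
    (l.map fun z => FreeGroup.mk [z]).prod = FreeGroup.mk l := by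
  induction l with
  | nil => rfl
  | cons z l ih => rw [List.map_cons, List.prod_cons, ih, FreeGroup.mul_mk]; rfl

theorem gen_zpow_sign {s : ℚ} (hs : 0 ≤ s) (i : ℕ) :
    gen i ^ ((-1 : ℤ) ^ (⌊(i : ℚ) * s⌋.toNat)) = FreeGroup.mk [letter s.den s.num 0 i] := by
  have hfl : ⌊(i : ℚ) * s⌋ = (0 + i * s.num) / (s.den : ℤ) := by
    rw [← Rat.floor_intCast_div_natCast]
    conv_lhs => rw [← Rat.num_div_den s]
    push_cast
    ring_nf
  have hnn : 0 ≤ ⌊(i : ℚ) * s⌋ := Int.floor_nonneg.2 (by positivity)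
  obtain ⟨k, hk⟩ := Int.eq_ofNat_of_zero_le hnn
  rw [letter, ← hfl, hk, Int.toNat_natCast]
  rcases Nat.even_or_odd k with hev | hodd
  · simp [hev.neg_one_pow, hev, gen, FreeGroup.of]
  · simp [hodd.neg_one_pow, Nat.not_even_iff_odd.2 hodd, gen, FreeGroup.of, FreeGroup.invRev]

theorem uWord_eq_mk {s : ℚ} (hs : 0 ≤ s) :
    uWord s = FreeGroup.mk (window s.den s.num 0 0 (2 * s.den)) := by
  rw [← prod_mk_singleton, uWord, window, List.map_map]
  congr 1
  refine List.map_congr_left fun i _ => ?_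
  simpa using gen_zpow_sign hs i

theorem uWord_pow_eq_mk {s : ℚ} (hs : 0 ≤ s) (n : ℕ) :
    uWord s ^ n = FreeGroup.mk (window s.den s.num 0 0 (2 * s.den * n)) := by
  induction n with
  | zero => rfl
  | succ n ih =>
    rw [pow_succ', ih, uWord_eq_mk hs, FreeGroup.mul_mk, mul_add, mul_one, add_comm, window_append]
    congr 2
    have h := letter_periodic (q := s.num) (x := 0) s.den_pos 1
    refine List.map_congr_left fun i _ => ?_
    simpa [add_comm] using (h i).symm

theorem toWord_uWord_pow {s : ℚ} (hs : 0 ≤ s) (n : ℕ) :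
    (uWord s ^ n).toWord = window s.den s.num 0 0 (2 * s.den * n) := by
  rw [uWord_pow_eq_mk hs, toWord_mk_window]

theorem toWord_uWord {s : ℚ} (hs : 0 ≤ s) :
    (uWord s).toWord = window s.den s.num 0 0 (2 * s.den) := by
  simpa using toWord_uWord_pow hs 1

theorem ediv_neg_sub_one {a b : ℤ} (hb : 0 < b) : (-a) / b = -((a - 1) / b) - 1 := by
  have h1 := Int.mul_ediv_add_emod (a - 1) b
  have h2 := Int.emod_nonneg (a - 1) hb.ne'
  have h3 := Int.emod_lt_of_pos (a - 1) hb
  rw [Int.ediv_eq_iff_of_pos hb]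
  constructor <;> nlinarith

theorem invRev_window (hp : 0 < p) (n : ℕ) :
    FreeGroup.invRev (window p q 0 0 (2 * p * n)) = window p q (-1) 1 (2 * p * n) := by
  refine List.ext_getElem (by simp [FreeGroup.invRev]) fun i h₁ h₂ => ?_
  have hi : i < 2 * p * n := by simpa using h₂
  simp only [FreeGroup.invRev, List.getElem_reverse, List.getElem_map, getElem_window,
    List.length_map, length_window, letter, Prod.mk.injEq, Fin.mk.injEq]
  have hN : 2 * p * n = 2 * (p * n) := mul_assoc _ _ _
  refine ⟨by omega, ?_⟩
  have hcast : ((0 + (2 * p * n - 1 - i) : ℕ) : ℤ) = 2 * p * n - 1 - i := by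
    rw [zero_add]; push_cast [Nat.sub_sub, Nat.cast_sub (show 1 + i ≤ 2 * p * n by omega)]; ring
  rw [hcast, show (0 : ℤ) + (2 * p * n - 1 - i) * q = -((1 + i) * q) + p * (2 * (n * q)) by ring,
    Int.add_mul_ediv_left _ _ (by omega), ediv_neg_sub_one (by omega),
    show (-1 : ℤ) + ((1 + i : ℕ) : ℤ) * q = (1 + i) * q - 1 by push_cast; ring]
  rw [← decide_not, decide_eq_decide]
  simp [Int.even_add]

theorem toWord_inv_uWord_pow {s : ℚ} (hs : 0 ≤ s) (n : ℕ) :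
    ((uWord s ^ n)⁻¹).toWord = window s.den s.num (-1) 1 (2 * s.den * n) := by
  rw [FreeGroup.toWord_inv, toWord_uWord_pow hs, invRev_window s.den_pos]

/-! ### Pieces -/

theorem mk_window_mem_Rset {r : ℚ} (hr : 0 ≤ r) (n : ℕ) (hx : x = 0 ∨ x = -1) (g : ℕ) :
    FreeGroup.mk (window r.den r.num x g (2 * r.den * n)) ∈ Rset r n := by
  rcases hx with rfl | rfl
  · refine Or.inl ⟨g, ?_⟩
    rw [toWord_uWord_pow hr, window_rotate r.den_pos, zero_add]
  · rcases Nat.eq_zero_or_pos n with rfl | hn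
    · exact Or.inl ⟨0, by simp [window]⟩
    refine Or.inr ⟨g + (2 * r.den * n - 1), ?_⟩
    have hpos : 0 < 2 * r.den * n := by have := r.den_pos; positivity
    rw [toWord_inv_uWord_pow hr, window_rotate r.den_pos,
      show 1 + (g + (2 * r.den * n - 1)) = g + 2 * r.den * n by omega]
    congr 1
    refine List.map_congr_left fun i _ => ?_
    rw [add_right_comm]
    exact (letter_periodic r.den_pos n _).symm

/-- The offset of a window can be moved one unit up or down, modulo `2 * p`, by passing from
`u_r` to `u_r⁻¹` or vice versa. -/
theorem exists_shifted_start (hp : 0 < p) (hpq : IsCoprime (p : ℤ) q) (hx : x = 0 ∨ x = -1)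
    (g : ℕ) {d : ℤ} (hd : d = 1 ∨ d = -1) :
    ∃ (y : ℤ) (h : ℕ) (c : ℤ), (y = 0 ∨ y = -1) ∧ h % 2 = g % 2 ∧
      y + h * q = x + g * q + d + p * (2 * c) := by
  have hsolve : ∀ t : ℤ, ∃ (e : ℕ) (c : ℤ), (e : ℤ) * q = t + p * c := by
    intro t
    obtain ⟨a, b, hab⟩ := hpq
    refine ⟨(t * b % p).toNat, -(t * a) - (t * b / p) * q, ?_⟩
    rw [Int.toNat_of_nonneg (Int.emod_nonneg _ (by omega)), Int.emod_def]
    linear_combination t * hab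
  rcases hx with rfl | rfl <;> rcases hd with rfl | rfl
  · obtain ⟨e, c, he⟩ := hsolve 1
    exact ⟨-1, g + 2 * e, c, Or.inr rfl, by omega, by push_cast; linear_combination 2 * he⟩
  · exact ⟨-1, g, 0, Or.inr rfl, rfl, by ring⟩
  · exact ⟨0, g, 0, Or.inl rfl, rfl, by ring⟩
  · obtain ⟨e, c, he⟩ := hsolve (-1)
    exact ⟨0, g + 2 * e, c, Or.inl rfl, by omega, by push_cast; linear_combination 2 * he⟩

theorem ediv_sub_one_of_not_dvd {a b : ℤ} (hb : 0 < b) (h : ¬ b ∣ a) : (a - 1) / b = a / b := by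
  have h1 := Int.mul_ediv_add_emod a b
  have h2 := Int.emod_nonneg a hb.ne'
  have h3 := Int.emod_lt_of_pos a hb
  have h4 : a % b ≠ 0 := fun h' => h (Int.dvd_of_emod_eq_zero h')
  have h5 : 1 ≤ a % b := by omega
  rw [Int.ediv_eq_iff_of_pos hb]
  constructor <;> nlinarith

theorem ediv_sub_one_of_dvd {a b : ℤ} (hb : 0 < b) (h : b ∣ a) : (a - 1) / b = a / b - 1 := by
  obtain ⟨c, rfl⟩ := h
  rw [Int.mul_ediv_cancel_left _ hb.ne', Int.ediv_eq_iff_of_pos hb]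
  constructor <;> nlinarith

theorem exists_dvd_add_mul (hp : 0 < p) (hpq : IsCoprime (p : ℤ) q) (x : ℤ) :
    ∃ z < p, ∀ j : ℕ, (p : ℤ) ∣ x + j * q ↔ (p : ℤ) ∣ j - z := by
  obtain ⟨a, b, hab⟩ := hpq
  have hz := Int.emod_nonneg (-(x * b)) (show (p : ℤ) ≠ 0 by omega)
  refine ⟨(-(x * b) % p).toNat, ?_, fun j => ?_⟩
  · zify
    rw [Int.toNat_of_nonneg hz]
    exact Int.emod_lt_of_pos _ (by omega)
  · rw [Int.toNat_of_nonneg hz, Int.emod_def]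
    constructor
    · rintro ⟨c, hc⟩
      exact ⟨b * c + j * a + (-(x * b) / p), by
        linear_combination (-j : ℤ) * hab + b * hc⟩
    · rintro ⟨c, hc⟩
      exact ⟨q * c - (-(x * b) / p) * q + x * a, by
        linear_combination q * hc - x * hab⟩

/-- A nonempty window of length at most that of `u_r ^ n` is a piece as soon as shifting its
offset by one unit in some direction changes none of its letters. -/
theorem isPiece_window {r : ℚ} (hr : 0 ≤ r) {n : ℕ} (hn : 0 < n) (hx : x = 0 ∨ x = -1)
    (hL : 0 < L) (hLN : L ≤ 2 * r.den * n)
    (hmiss : (∀ j < L, ¬ (r.den : ℤ) ∣ x + (g + j : ℕ) * r.num) ∨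
      ∀ j < L, ¬ (r.den : ℤ) ∣ x + 1 + (g + j : ℕ) * r.num) :
    IsPiece r n (window r.den r.num x g L) := by
  have hp := r.den_pos
  have hpz : (0 : ℤ) < r.den := by exact_mod_cast hp
  have hpq : IsCoprime (r.den : ℤ) r.num := by
    rw [Int.isCoprime_iff_nat_coprime]; simpa using r.reduced.symm
  obtain ⟨d, e, hd, hde, hmiss⟩ : ∃ d e : ℤ, (d = 1 ∨ d = -1) ∧
      (d = 1 ∧ e = 1 ∨ d = -1 ∧ e = 0) ∧
      ∀ j < L, ¬ (r.den : ℤ) ∣ x + e + (g + j : ℕ) * r.num := by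
    rcases hmiss with h | h
    · exact ⟨-1, 0, by simp, by simp, by simpa using h⟩
    · exact ⟨1, 1, by simp, by simp, h⟩
  obtain ⟨y, h, c, hy, hpar, hyh⟩ := exists_shifted_start hp hpq hx g hd
  have key : ∀ j : ℕ, (y + (h + j : ℕ) * r.num) / (r.den : ℤ)
      = (x + (g + j : ℕ) * r.num + d) / (r.den : ℤ) + 2 * c := by
    intro j
    rw [← Int.add_mul_ediv_left _ _ hpz.ne']
    congr 1
    push_cast
    linear_combination hyh
  have hsame : ∀ j : ℕ, ¬ (r.den : ℤ) ∣ x + e + (g + j : ℕ) * r.num →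
      letter r.den r.num y (h + j) = letter r.den r.num x (g + j) := by
    intro j hj
    refine letter_congr (by omega) c ?_
    rw [key j]
    congr 1
    rcases hde with ⟨rfl, rfl⟩ | ⟨rfl, rfl⟩
    · rw [← ediv_sub_one_of_not_dvd hpz (a := x + (g + j : ℕ) * r.num + 1)
        (by rwa [add_right_comm]), add_sub_cancel_right]
    · exact ediv_sub_one_of_not_dvd hpz (by simpa using hj)
  have hdiff : ∀ j : ℕ, (r.den : ℤ) ∣ x + e + (g + j : ℕ) * r.num →
      letter r.den r.num y (h + j) ≠ letter r.den r.num x (g + j) := by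
    intro j hj heq
    have h2 := (Prod.mk.inj heq).2
    rw [decide_eq_decide, key j] at h2
    rcases hde with ⟨rfl, rfl⟩ | ⟨rfl, rfl⟩
    · have h3 := ediv_sub_one_of_dvd hpz (a := x + (g + j : ℕ) * r.num + 1)
        (by rwa [add_right_comm])
      rw [add_sub_cancel_right] at h3
      rw [h3] at h2
      simp only [Int.even_iff] at h2
      omega
    · have h3 := ediv_sub_one_of_dvd hpz (a := x + (g + j : ℕ) * r.num) (by simpa using hj)
      rw [← sub_eq_add_neg, h3] at h2
      simp only [Int.even_iff] at h2
      omega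
  have hwin : window r.den r.num x g L = window r.den r.num y h L :=
    List.map_congr_left fun j hj => (hsame j (hmiss j (List.mem_range.1 hj))).symm
  refine ⟨fun h => ?_, _, mk_window_mem_Rset hr n hx g, _, mk_window_mem_Rset hr n hy h, ?_, ?_, ?_⟩
  · have := congrArg List.length h
    simp at this
    omega
  · intro heq
    obtain ⟨z, hz, hzdvd⟩ := exists_dvd_add_mul hp hpq (x + e + g * r.num)
    have hzN : z < 2 * r.den * n := by nlinarith
    have hlist := congrArg FreeGroup.toWord heq
    rw [toWord_mk_window, toWord_mk_window] at hlist
    refine hdiff z ?_ ?_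
    · have := (hzdvd z).2 (by simp)
      rwa [Nat.cast_add, add_mul, ← add_assoc]
    · have := List.getElem_of_eq hlist (i := z) (by simpa using hzN)
      rw [getElem_window, getElem_window] at this
      exact this.symm
  · rw [toWord_mk_window]
    exact window_prefix hLN
  · rw [toWord_mk_window, hwin]
    exact window_prefix hLN

/-! ### Covering a window by few pieces -/

theorem IsProdOfPieces.exists_append {r : ℚ} {n c : ℕ} {w w' : List (Fin 2 × Bool)}
    (hw : ∃ j ≤ c, IsProdOfPieces r n j w) (hw' : w' = [] ∨ IsPiece r n w') :
    ∃ j ≤ c + 1, IsProdOfPieces r n j (w ++ w') := by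
  obtain ⟨j, hj, ps, hlen, hps, hflat⟩ := hw
  rcases hw' with rfl | hw'
  · exact ⟨j, by omega, ps, hlen, hps, by simpa using hflat⟩
  · refine ⟨j + 1, by omega, ps ++ [w'], by simp [hlen], fun a ha => ?_, by simp [hflat]⟩
    rcases List.mem_append.1 ha with ha | ha
    · exact hps a ha
    · rwa [List.mem_singleton.1 ha]

theorem not_dvd_of_between {a b t : ℤ} (hb : 0 < b) (h₁ : t * b < a) (h₂ : a < (t + 1) * b) :
    ¬ b ∣ a := by
  rintro ⟨c, rfl⟩
  rw [mul_comm b c] at h₁ h₂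
  have := lt_of_mul_lt_mul_right h₁ hb.le
  have := lt_of_mul_lt_mul_right h₂ hb.le
  omega

/-- If a window meets two interleaved residue classes `z < v` modulo `p`, and windows avoiding
either class are empty or pieces, then cutting at the elements of both classes alternately writes
it as a product of few pieces. -/
theorem exists_prod_of_alternating {r : ℚ} {n z v : ℕ} (hp : 0 < p) (hzv : z < v)
    (hvp : v < p)
    (hpiece : ∀ A B, A ≤ B → B ≤ L →
      ((∀ j : ℕ, A ≤ j → j < B → ¬ (p : ℤ) ∣ j - z) ∨
        ∀ j : ℕ, A ≤ j → j < B → ¬ (p : ℤ) ∣ j - v) →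
      window p q x (g + A) (B - A) = [] ∨ IsPiece r n (window p q x (g + A) (B - A))) (t : ℕ) :
    (∀ B ≤ L, B ≤ v + t * p → ∃ j ≤ 2 * t + 1, IsProdOfPieces r n j (window p q x g B)) ∧
    ∀ B ≤ L, B ≤ z + (t + 1) * p → ∃ j ≤ 2 * t + 2, IsProdOfPieces r n j (window p q x g B) := by
  have hpz : (0 : ℤ) < p := by exact_mod_cast hp
  have hvzp : v < z + p := by omega
  have step : ∀ A B c, A ≤ B → B ≤ L →
      (∃ j ≤ c, IsProdOfPieces r n j (window p q x g A)) →
      ((∀ j : ℕ, A ≤ j → j < B → ¬ (p : ℤ) ∣ j - z) ∨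
        ∀ j : ℕ, A ≤ j → j < B → ¬ (p : ℤ) ∣ j - v) →
      ∃ j ≤ c + 1, IsProdOfPieces r n j (window p q x g B) := by
    intro A B c hAB hB hA hmiss
    have := IsProdOfPieces.exists_append hA (hpiece A B hAB hB hmiss)
    rwa [← window_append, Nat.add_sub_cancel' hAB] at this
  have second : ∀ t : ℕ,
      (∀ B ≤ L, B ≤ v + t * p → ∃ j ≤ 2 * t + 1, IsProdOfPieces r n j (window p q x g B)) →
      ∀ B ≤ L, B ≤ z + (t + 1) * p →
        ∃ j ≤ 2 * t + 2, IsProdOfPieces r n j (window p q x g B) := by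
    intro t ih B hB hBt
    rcases le_total B (v + t * p) with h | h
    · obtain ⟨j, hj, hprod⟩ := ih B hB h
      exact ⟨j, by omega, hprod⟩
    · refine step (v + t * p) B _ h hB (ih _ (h.trans hB) le_rfl) (Or.inl fun j h₁ h₂ => ?_)
      refine not_dvd_of_between (t := t) hpz ?_ ?_ <;> zify at * <;> linarith
  induction t with
  | zero =>
    have first : ∀ B ≤ L, B ≤ v + 0 * p →
        ∃ j ≤ 2 * 0 + 1, IsProdOfPieces r n j (window p q x g B) := by
      intro B hB hBv
      refine step 0 B 0 (Nat.zero_le _) hB ⟨0, le_rfl, [], rfl, by simp, rfl⟩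
        (Or.inr fun j _ h₂ => ?_)
      refine not_dvd_of_between (t := -1) hpz ?_ ?_ <;> zify at * <;> linarith
    exact ⟨first, second 0 first⟩
  | succ t ih =>
    have first : ∀ B ≤ L, B ≤ v + (t + 1) * p →
        ∃ j ≤ 2 * (t + 1) + 1, IsProdOfPieces r n j (window p q x g B) := by
      intro B hB hBt
      rcases le_total B (z + (t + 1) * p) with h | h
      · obtain ⟨j, hj, hprod⟩ := ih.2 B hB h
        exact ⟨j, by omega, hprod⟩
      · refine step _ B _ h hB (ih.2 _ (h.trans hB) le_rfl) (Or.inr fun j h₁ h₂ => ?_)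
        refine not_dvd_of_between (t := t) hpz ?_ ?_ <;> zify at * <;> linarith
    exact ⟨first, second _ first⟩

/-- A window that is not a product of fewer than `4 * n - 1` pieces contains two points
`(2 * n - 1) * p` apart at which the line passes through (or just below) lattice points. -/
theorem exists_lattice_points {r : ℚ} (hr : 0 ≤ r) (hden : 2 ≤ r.den) {n : ℕ} (hn : 0 < n)
    (hx : x = 0 ∨ x = -1) (hLN : L ≤ 2 * r.den * n)
    (hmin : ∀ j < 4 * n - 1, ¬ IsProdOfPieces r n j (window r.den r.num x g L)) :
    ∃ i, i + (2 * n - 1) * r.den < L ∧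
      ((r.den : ℤ) ∣ x + (g + i : ℕ) * r.num ∨ (r.den : ℤ) ∣ x + 1 + (g + i : ℕ) * r.num) := by
  have hp := r.den_pos
  have hpq : IsCoprime (r.den : ℤ) r.num := by
    rw [Int.isCoprime_iff_nat_coprime]; simpa using r.reduced.symm
  obtain ⟨z, hz, hzdvd⟩ := exists_dvd_add_mul hp hpq (x + g * r.num)
  obtain ⟨v, hv, hvdvd⟩ := exists_dvd_add_mul hp hpq (x + 1 + g * r.num)
  have hz' : ∀ j : ℕ, (r.den : ℤ) ∣ x + (g + j : ℕ) * r.num ↔ (r.den : ℤ) ∣ j - z := fun j => by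
    rw [← hzdvd, Nat.cast_add, add_mul, ← add_assoc]
  have hv' : ∀ j : ℕ, (r.den : ℤ) ∣ x + 1 + (g + j : ℕ) * r.num ↔ (r.den : ℤ) ∣ j - v :=
    fun j => by rw [← hvdvd, Nat.cast_add, add_mul, ← add_assoc]
  have hzv : z ≠ v := by
    rintro rfl
    have h1 := (hz' z).2 (by simp)
    have h2 := (hv' z).2 (by simp)
    have h3 := Int.dvd_sub h2 h1
    rw [show x + 1 + (g + z : ℕ) * r.num - (x + (g + z : ℕ) * r.num) = 1 by ring] at h3
    have := Int.le_of_dvd one_pos h3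
    omega
  have hpiece : ∀ A B, A ≤ B → B ≤ L →
      ((∀ j : ℕ, A ≤ j → j < B → ¬ (r.den : ℤ) ∣ j - z) ∨
        ∀ j : ℕ, A ≤ j → j < B → ¬ (r.den : ℤ) ∣ j - v) →
      window r.den r.num x (g + A) (B - A) = [] ∨
        IsPiece r n (window r.den r.num x (g + A) (B - A)) := by
    intro A B hAB hB hmiss
    rcases Nat.eq_zero_or_pos (B - A) with h0 | h0
    · exact Or.inl (by simp [h0, window])
    refine Or.inr (isPiece_window hr hn hx h0 (by omega) (hmiss.imp ?_ ?_))
    · intro h j hj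
      rw [add_assoc g, hz']
      exact h _ (by omega) (by omega)
    · intro h j hj
      rw [add_assoc g, hv']
      exact h _ (by omega) (by omega)
  obtain ⟨t, rfl⟩ := Nat.exists_eq_add_of_lt hn
  have ht : 2 * (0 + t + 1) - 1 = 2 * t + 1 := by omega
  rw [ht]
  by_contra! hcon
  have finish : L ≤ min z v + (2 * t + 1) * r.den → False := by
    intro hL
    have : ∃ j ≤ 2 * (2 * t) + 2, IsProdOfPieces r (0 + t + 1) j (window r.den r.num x g L) := by
      rcases lt_or_gt_of_ne hzv with h | h
      · rw [min_eq_left h.le] at hL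
        exact (exists_prod_of_alternating hp h hv hpiece (2 * t)).2 L le_rfl hL
      · rw [min_eq_right h.le] at hL
        exact (exists_prod_of_alternating hp h hz
          (fun A B h₁ h₂ h₃ => hpiece A B h₁ h₂ h₃.symm) (2 * t)).2 L le_rfl hL
    obtain ⟨j, hj, hprod⟩ := this
    exact hmin j (by omega) hprod
  refine finish (not_lt.1 fun hlt => ?_)
  rcases min_choice z v with h | h <;> rw [h] at hlt
  · exact (hcon z hlt).1 ((hz' z).2 (by simp))
  · exact (hcon v hlt).2 ((hv' v).2 (by simp))

/-! ### Comparing slopes -/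

theorem ediv_step {a b c : ℤ} (hb : 0 < b) (hc : 0 ≤ c) (hcb : c ≤ b) :
    (a + c) / b = a / b ∨ (a + c) / b = a / b + 1 := by
  have h1 := Int.mul_ediv_add_emod a b
  have h2 := Int.emod_nonneg a hb.ne'
  have h3 := Int.emod_lt_of_pos a hb
  rcases lt_or_ge (a % b + c) b with h | h
  · left
    rw [Int.ediv_eq_iff_of_pos hb]
    constructor <;> nlinarith
  · right
    rw [Int.ediv_eq_iff_of_pos hb]
    constructor <;> nlinarith

/-- For slopes in `[0, 1]`, the parities of the heights determine their increments. -/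
theorem ediv_sub_eq_of_even_iff {p Q : ℤ} {q P X Y : ℤ} (hp : 0 < p) (hQ : 0 < Q) (hq : 0 ≤ q)
    (hqp : q ≤ p) (hP : 0 ≤ P) (hPQ : P ≤ Q) {J : ℕ}
    (heven : ∀ i : ℕ, i ≤ J → (Even ((X + i * q) / p) ↔ Even ((Y + i * P) / Q))) :
    ∀ i : ℕ, i ≤ J → (X + i * q) / p - X / p = (Y + i * P) / Q - Y / Q := by
  intro i
  induction i with
  | zero => simp
  | succ i ih =>
    intro hi
    have h0 := ih (by omega)
    have e0 := heven i (by omega)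
    have e1 := heven (i + 1) hi
    have h1 := ediv_step (a := X + i * q) hp hq hqp
    have h2 := ediv_step (a := Y + i * P) hQ hP hPQ
    rw [show X + ((i + 1 : ℕ) : ℤ) * q = X + i * q + q by push_cast; ring,
      show Y + ((i + 1 : ℕ) : ℤ) * P = Y + i * P + P by push_cast; ring] at *
    simp only [Int.even_iff] at e0 e1
    omega

/-- If a line of slope `P / Q` has the same height increments, over `k * p` steps, as a line of
slope `q / p` starting at or just below a lattice point, then `P / Q` is on the same side as
`q / p` of every fraction with denominator at most `k * p` other than `q / p`. -/
theorem slope_compare {p Q q P X Y : ℤ} (hp : 0 < p) (hQ : 0 < Q) {k : ℕ} {J : ℕ}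
    (hJ : (J : ℤ) = k * p)
    (hinc : ∀ i : ℕ, i ≤ J → (X + i * q) / p - X / p = (Y + i * P) / Q - Y / Q)
    (hX : p ∣ X ∨ p ∣ X + 1) {i : ℕ} (hiJ : i ≤ J) (h : ℤ) :
    (h * p < i * q → h * Q < i * P) ∧ (i * q < h * p → i * P < h * Q) := by
  have upper : ∀ j l : ℕ, j ≤ J → l ≤ J → ∀ D : ℤ,
      (X + j * q) / p - (X + l * q) / p = D → (D - 1) * Q < (j - l) * P ∧
        (j - l) * P < (D + 1) * Q := by
    intro j l hj hl D hD
    have hD' : (Y + j * P) / Q - (Y + l * P) / Q = D := by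
      have := hinc j hj
      have := hinc l hl
      omega
    have a1 := Int.mul_ediv_add_emod (Y + j * P) Q
    have a2 := Int.emod_nonneg (Y + j * P) hQ.ne'
    have a3 := Int.emod_lt_of_pos (Y + j * P) hQ
    have b1 := Int.mul_ediv_add_emod (Y + l * P) Q
    have b2 := Int.emod_nonneg (Y + l * P) hQ.ne'
    have b3 := Int.emod_lt_of_pos (Y + l * P) hQ
    subst hD'
    constructor <;> nlinarith
  have hJi : ((J - i : ℕ) : ℤ) = k * p - i := by rw [Nat.cast_sub hiJ, hJ]
  rcases hX with ⟨c, hc⟩ | ⟨c, hc⟩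
  · have e0 : (X + ((0 : ℕ) : ℤ) * q) / p = c := by
      rw [Int.ediv_eq_iff_of_pos hp]; constructor <;> push_cast <;> nlinarith
    have eJ : (X + J * q) / p = c + k * q := by
      rw [Int.ediv_eq_iff_of_pos hp, hJ]; constructor <;> nlinarith
    constructor <;> intro hlt
    · have : (X + (J - i : ℕ) * q) / p < c + k * q - h := by
        rw [Int.ediv_lt_iff_lt_mul hp, hJi]
        nlinarith
      have := (upper J (J - i) le_rfl (Nat.sub_le _ _) _ rfl).1
      rw [eJ, show (J : ℤ) - (J - i : ℕ) = i by omega] at this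
      nlinarith
    · have : (X + i * q) / p < c + h := by
        rw [Int.ediv_lt_iff_lt_mul hp]
        nlinarith
      have := (upper i 0 hiJ (Nat.zero_le _) _ rfl).2
      rw [e0] at this
      push_cast at this
      nlinarith
  · have e0 : (X + ((0 : ℕ) : ℤ) * q) / p = c - 1 := by
      rw [Int.ediv_eq_iff_of_pos hp]; constructor <;> push_cast <;> nlinarith
    have eJ : (X + J * q) / p = c + k * q - 1 := by
      rw [Int.ediv_eq_iff_of_pos hp, hJ]; constructor <;> nlinarith
    constructor <;> intro hlt
    · have : c + h ≤ (X + i * q) / p := by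
        rw [Int.le_ediv_iff_mul_le hp]
        nlinarith
      have := (upper i 0 hiJ (Nat.zero_le _) _ rfl).1
      rw [e0] at this
      push_cast at this
      nlinarith
    · have : c + k * q - h ≤ (X + (J - i : ℕ) * q) / p := by
        rw [Int.le_ediv_iff_mul_le hp, hJi]
        nlinarith
      have := (upper J (J - i) le_rfl (Nat.sub_le _ _) _ rfl).2
      rw [eJ, show (J : ℤ) - (J - i : ℕ) = i by omega] at this
      nlinarith

/-! ### Continued fractions -/

theorem cfQ_nonneg (l : List ℕ) : 0 ≤ cfQ l := by
  induction l with
  | nil => exact le_rfl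
  | cons a l ih => rw [cfQ]; positivity

theorem cfQ_le_one {l : List ℕ} (hl : ∀ a ∈ l, 0 < a) : cfQ l ≤ 1 := by
  cases l with
  | nil => exact zero_le_one
  | cons a l =>
    have h1 : (1 : ℚ) ≤ a := by exact_mod_cast hl a (by simp)
    have h2 := cfQ_nonneg l
    rw [cfQ, div_le_one (by positivity)]
    linarith

theorem exists_cfQ_append (l : List ℕ) (hl : ∀ a ∈ l, 0 < a) :
    ∃ A B C D : ℕ, 0 < C ∧ (A * D : ℤ) - B * C = (-1) ^ (l.length + 1) ∧
      ∀ l' : List ℕ, cfQ (l ++ l') = (A + B * cfQ l') / (C + D * cfQ l') := by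
  induction l with
  | nil => exact ⟨0, 1, 1, 0, one_pos, by simp, fun l' => by simp⟩
  | cons a l ih =>
    obtain ⟨A, B, C, D, hC, hdet, hcf⟩ := ih fun b hb => hl b (by simp [hb])
    have ha : 0 < a := hl a (by simp)
    refine ⟨C, D, a * C + A, a * D + B, by positivity, ?_, fun l' => ?_⟩
    · rw [List.length_cons, pow_succ, ← hdet]
      push_cast
      ring
    · have h1 := cfQ_nonneg l'
      have hC' : (0 : ℚ) < C := by exact_mod_cast hC
      have ha' : (0 : ℚ) < a := by exact_mod_cast ha
      rw [List.cons_append, cfQ, hcf]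
      have : (C : ℚ) + D * cfQ l' ≠ 0 := by positivity
      push_cast
      field_simp
      ring

/-- For `l = M ++ [k]`, the endpoints `[M, k - 1, 2]` and `[M, k, N]` are fractions with
denominators at most `(N + 1) * p` on either side of `r = [M, k]`, where `p` is the denominator
of `r`. -/
theorem exists_endpoints {M : List ℕ} {k N : ℕ} (hM : ∀ a ∈ M, 0 < a) (hk : 2 ≤ k) (hN : 0 < N) :
    2 ≤ (cfQ (M ++ [k])).den ∧ ∃ h₁ i₁ h₂ i₂ : ℕ,
      cfQ (M ++ [k - 1, 2]) = h₁ / i₁ ∧ cfQ (M ++ [k, N]) = h₂ / i₂ ∧ 0 < i₁ ∧ 0 < i₂ ∧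
      i₁ ≤ (N + 1) * (cfQ (M ++ [k])).den ∧ i₂ ≤ (N + 1) * (cfQ (M ++ [k])).den ∧
      (h₁ * (cfQ (M ++ [k])).den : ℤ) - i₁ * (cfQ (M ++ [k])).num = (-1) ^ M.length ∧
      (h₂ * (cfQ (M ++ [k])).den : ℤ) - i₂ * (cfQ (M ++ [k])).num = (-1) ^ (M.length + 1) := by
  obtain ⟨A, B, C, D, hC, hdet, hcf⟩ := exists_cfQ_append M hM
  obtain ⟨e, rfl⟩ := Nat.exists_eq_add_of_le hk
  have hC' : (0 : ℚ) < C := by exact_mod_cast hC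
  have hN' : (0 : ℚ) < N := by exact_mod_cast hN
  have hr : cfQ (M ++ [2 + e]) = ((A * (2 + e) + B : ℕ) : ℤ) / ((C * (2 + e) + D : ℕ) : ℤ) := by
    rw [hcf]
    simp only [cfQ]
    push_cast
    have h1 : (C : ℚ) * (2 + e) + D ≠ 0 := by positivity
    have h2 : (C : ℚ) + D * (1 / (2 + e + 0)) ≠ 0 := by positivity
    field_simp
    ring
  have hpos : 0 < C * (2 + e) + D := by positivity
  have hcop : Nat.Coprime (A * (2 + e) + B) (C * (2 + e) + D) := by
    rw [← Nat.isCoprime_iff_coprime]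
    have hsq : ((-1 : ℤ) ^ (M.length + 1)) * (-1) ^ (M.length + 1) = 1 := by
      rw [← mul_pow]; simp
    refine ⟨-(-1) ^ (M.length + 1) * C, (-1) ^ (M.length + 1) * A, ?_⟩
    push_cast
    linear_combination (-1) ^ (M.length + 1) * hdet + hsq
  have hnum : (cfQ (M ++ [2 + e])).num = (A * (2 + e) + B : ℕ) := by
    rw [hr]; exact Rat.num_div_eq_of_coprime (by exact_mod_cast hpos) hcop
  have hden : (cfQ (M ++ [2 + e])).den = C * (2 + e) + D := by
    have := Rat.den_div_eq_of_coprime (a := (A * (2 + e) + B : ℕ)) (b := (C * (2 + e) + D : ℕ))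
      (by exact_mod_cast hpos) hcop
    rw [← hr] at this
    exact_mod_cast this
  rw [hnum, hden]
  refine ⟨by nlinarith, A * (3 + 2 * e) + 2 * B, C * (3 + 2 * e) + 2 * D,
    A + N * (A * (2 + e) + B), C + N * (C * (2 + e) + D), ?_, ?_, by positivity, by positivity,
    by nlinarith, by nlinarith, ?_, ?_⟩
  · rw [hcf, show 2 + e - 1 = 1 + e by omega]
    simp only [cfQ]
    push_cast
    have h1 : (C : ℚ) + D * (1 / (1 + e + 1 / (2 + 0))) ≠ 0 := by positivity
    have h2 : (C : ℚ) * (3 + 2 * e) + 2 * D ≠ 0 := by positivity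
    have h3 : (1 : ℚ) + e + 1 / (2 + 0) ≠ 0 := by positivity
    field_simp
    ring
  · rw [hcf]
    simp only [cfQ]
    push_cast
    have h1 : (C : ℚ) + D * (1 / (2 + e + 1 / (N + 0))) ≠ 0 := by positivity
    have h2 : (C : ℚ) + N * (C * (2 + e) + D) ≠ 0 := by positivity
    have h3 : (2 : ℚ) + e + 1 / (N + 0) ≠ 0 := by positivity
    field_simp
    ring
  · push_cast
    rw [pow_succ] at hdet
    linear_combination -hdet
  · push_cast
    linear_combination hdet

theorem num_le_den_of_le_one {s : ℚ} (hs : s ≤ 1) : s.num ≤ s.den := by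
  have := Rat.le_iff s 1 |>.1 hs
  simpa using this

/-- If the cyclic word `(u_s)` contains a subword of `(u_r ^ n)` or `(u_r ^ (-n))` that is not a
product of fewer than `4 * n - 1` pieces, then `s` and `r` lie on the same side of every fraction
with denominator at most `(2 * n - 1) * r.den` other than `r`. -/
theorem compare_of_contains {r s : ℚ} (hr : 0 ≤ r) (hr1 : r ≤ 1) (hden : 2 ≤ r.den)
    (hs : 0 ≤ s) (hs1 : s ≤ 1) {n : ℕ} (hn : 0 < n) {w : List (Fin 2 × Bool)}
    (hws : ∃ k, w <:+: (uWord s).toWord.rotate k)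
    (hwr : ∃ k, w <:+: (uWord r ^ n).toWord.rotate k ∨
      w <:+: ((uWord r ^ n)⁻¹).toWord.rotate k)
    (hmin : ∀ j < 4 * n - 1, ¬ IsProdOfPieces r n j w)
    {h i : ℕ} (hi : i ≤ (2 * n - 1) * r.den) :
    ((h * r.den : ℤ) < i * r.num → (h * s.den : ℤ) < i * s.num) ∧
      ((i * r.num : ℤ) < h * r.den → (i * s.num : ℤ) < h * s.den) := by
  obtain ⟨k, hws⟩ := hws
  have hrot := window_rotate (q := s.num) (x := 0) (g := 0) s.den_pos 1 k
  rw [mul_one] at hrot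
  rw [toWord_uWord hs, hrot] at hws
  obtain ⟨gs, -, hws⟩ := infix_window hws
  obtain ⟨x, gr, hx, hwN, hwr⟩ : ∃ (x : ℤ) (gr : ℕ), (x = 0 ∨ x = -1) ∧
      w.length ≤ 2 * r.den * n ∧ w = window r.den r.num x gr w.length := by
    obtain ⟨k, hwr | hwr⟩ := hwr
    · rw [toWord_uWord_pow hr, window_rotate r.den_pos] at hwr
      obtain ⟨g, h₁, h₂⟩ := infix_window hwr
      exact ⟨0, g, Or.inl rfl, h₁, h₂⟩
    · rw [toWord_inv_uWord_pow hr, window_rotate r.den_pos] at hwr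
      obtain ⟨g, h₁, h₂⟩ := infix_window hwr
      exact ⟨-1, g, Or.inr rfl, h₁, h₂⟩
  obtain ⟨i₀, hi₀, hdvd⟩ := exists_lattice_points (g := gr) hr hden hn hx hwN (by rwa [← hwr])
  have heven : ∀ j : ℕ, j ≤ (2 * n - 1) * r.den →
      (Even ((x + (gr + i₀ : ℕ) * r.num + j * r.num) / (r.den : ℤ)) ↔
        Even (((gs + i₀ : ℕ) * s.num + j * s.num) / (s.den : ℤ))) := by
    intro j hj
    have hlen : i₀ + j < w.length := by omega
    have h1 := List.getElem_of_eq hws hlen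
    have h2 := List.getElem_of_eq hwr hlen
    rw [getElem_window] at h1 h2
    have h3 := (Prod.mk.inj (h2.symm.trans h1)).2
    rw [decide_eq_decide] at h3
    convert h3 using 3 <;> push_cast <;> ring
  have hpz : (0 : ℤ) < r.den := by exact_mod_cast r.den_pos
  have hQz : (0 : ℤ) < s.den := by exact_mod_cast s.den_pos
  refine slope_compare (k := 2 * n - 1) hpz hQz (Nat.cast_mul _ _)
    (ediv_sub_eq_of_even_iff hpz hQz (Rat.num_nonneg.2 hr) (num_le_den_of_le_one hr1)
      (Rat.num_nonneg.2 hs) (num_le_den_of_le_one hs1) heven) ?_ hi h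
  refine hdvd.imp id fun hd => ?_
  rwa [add_right_comm]

/-- Corollary 2.2: for `s ∈ I₁(r;n) ∪ I₂(r;n)`, the cyclic word `(u_s)` cannot
contain a subword `w` of the cyclic word `(u_r^{±n})` which is a product of
`4n-1` pieces but is not a product of fewer than `4n-1` pieces. -/
theorem statement3
    (M : List ℕ) (m n : ℕ) (r : ℚ)
    (hMlen : 2 ≤ M.length) (hMpos : ∀ x ∈ M, 0 < x) (hMlast : 2 ≤ M.getLast!)
    (hm : M.head? = some m) (hn : 2 ≤ n) (hr : r = cfQ M)
    (s : ℚ) (hs : memI1 M n s ∨ memI2 M n s) :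
    ¬ ∃ w : List (Fin 2 × Bool),
      (∃ k, w <:+: (uWord s).toWord.rotate k) ∧
      (∃ k, w <:+: (uWord r ^ n).toWord.rotate k ∨
            w <:+: ((uWord r ^ n)⁻¹).toWord.rotate k) ∧
      IsProdOfPieces r n (4 * n - 1) w ∧
      (∀ j < 4 * n - 1, ¬ IsProdOfPieces r n j w) := by
  rintro ⟨w, hws, hwr, -, hmin⟩
  obtain ⟨M', k, rfl⟩ : ∃ M' k, M = M' ++ [k] :=
    ⟨M.dropLast, M.getLast (by rintro rfl; simp at hMlen),
      (List.dropLast_append_getLast _).symm⟩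
  have hk : (M' ++ [k]).getLast! = k := by simp [List.getLast!_eq_getLast?_getD]
  rw [hk] at hMlast
  have hM' : ∀ a ∈ M', 0 < a := fun a ha => hMpos a (by simp [ha])
  obtain ⟨hden, h₁, i₁, h₂, i₂, hl₁, hl₂, hi₁, hi₂, hb₁, hb₂, hd₁, hd₂⟩ :=
    exists_endpoints (N := 2 * n - 2) hM' hMlast (by omega)
  have hl₁_le : cfQ (M' ++ [k - 1, 2]) ≤ 1 := cfQ_le_one fun a ha => by
    simp only [List.mem_append, List.mem_cons, List.not_mem_nil, or_false] at ha
    rcases ha with ha | rfl | rfl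
    exacts [hM' a ha, by omega, by omega]
  have hl₂_le : cfQ (M' ++ [k, 2 * n - 2]) ≤ 1 := cfQ_le_one fun a ha => by
    simp only [List.mem_append, List.mem_cons, List.not_mem_nil, or_false] at ha
    rcases ha with ha | rfl | rfl
    exacts [hM' a ha, by omega, by omega]
  have hl₁_nn := cfQ_nonneg (M' ++ [k - 1, 2])
  have hl₂_nn := cfQ_nonneg (M' ++ [k, 2 * n - 2])
  rw [← hr] at hden hb₁ hb₂ hd₁ hd₂
  have hN : 2 * n - 2 + 1 = 2 * n - 1 := by omega
  rw [hN] at hb₁ hb₂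
  unfold memI1 memI2 at hs
  simp only [hk, List.dropLast_concat, List.append_assoc, List.cons_append, List.nil_append,
    List.length_append, List.length_singleton] at hs
  have hs01 : 0 ≤ s ∧ s ≤ 1 := by
    split_ifs at hs <;> rcases hs with hs | hs <;> constructor <;> linarith [hs.1, hs.2]
  have hr0 : 0 ≤ r := hr ▸ cfQ_nonneg _
  have hr1 : r ≤ 1 := hr ▸ cfQ_le_one hMpos
  have hcmp := fun h i => @compare_of_contains r s hr0 hr1 hden hs01.1 hs01.2 n (by omega) w
    hws hwr hmin h i
  have c₁ := hcmp h₁ i₁ hb₁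
  have c₂ := hcmp h₂ i₂ hb₂
  have hlt : ∀ h i : ℕ, 0 < i → (((h / i : ℚ) < s ↔ (h * s.den : ℤ) < i * s.num) ∧
      (s < (h / i : ℚ) ↔ (i * s.num : ℤ) < h * s.den)) := by
    intro h i hi
    have hi' : (0 : ℚ) < i := by exact_mod_cast hi
    have hd' : (0 : ℚ) < s.den := by exact_mod_cast s.den_pos
    constructor
    · conv_lhs => rw [← Rat.num_div_den s, div_lt_div_iff₀ hi' hd', mul_comm (s.num : ℚ)]
      norm_cast
    · conv_lhs => rw [← Rat.num_div_den s, div_lt_div_iff₀ hd' hi', mul_comm (s.num : ℚ)]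
      norm_cast
  rw [← (hlt h₁ i₁ hi₁).1, ← (hlt h₁ i₁ hi₁).2, ← hl₁] at c₁
  rw [← (hlt h₂ i₂ hi₂).1, ← (hlt h₂ i₂ hi₂).2, ← hl₂] at c₂
  rcases Nat.even_or_odd M'.length with hev | hodd
  · rw [hev.neg_one_pow] at hd₁
    rw [hev.add_one.neg_one_pow] at hd₂
    rw [if_neg (Nat.not_even_iff_odd.2 hev.add_one), if_neg (Nat.not_even_iff_odd.2 hev.add_one)]
      at hs
    have := c₁.2 (by linarith)
    have := c₂.1 (by linarith)
    rcases hs with hs | hs <;> linarith [hs.1, hs.2]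
  · rw [hodd.neg_one_pow] at hd₁
    rw [hodd.add_one.neg_one_pow] at hd₂
    rw [if_pos hodd.add_one, if_pos hodd.add_one] at hs
    have := c₁.1 (by linarith)
    have := c₂.2 (by linarith)
    rcases hs with hs | hs <;> linarith [hs.1, hs.2]

end Heckoid
end

section
/- For any rational number s ∈ I_1(r) ∪ I_2(r), at least one of the sequences S_1, S_2 does not occur in CS(s) as a subsequence. -/
/- Formalization of statements from "Homotopically equivalent simple loops on
2-bridge spheres in Heckoid orbifolds for 2-bridge links (II)" by Lee-Sakuma.

We work in the free group `F` on two generators `a = gen 0`, `b = gen 1`.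
For a rational `s` (in lowest terms `q/p`, with `0 ≤ s ≤ 1`), `uWord s` is the
word `u_s = a b^{ε₁} a^{ε₂} ⋯ b^{ε_{2p-1}}` with `ε_i = (-1)^⌊i·s⌋`.
`CS s` is (a linear representative of) the cyclic sequence of lengths of
maximal constant-sign runs of exponents of `u_s`; since `u_s` begins with a
positive letter and (for `0 < s ≤ 1`) ends with a negative letter, the linear
run-length sequence represents the cyclic one.  `CyclicContains L T` says the
cyclic sequence represented by `L` contains `T` as a block of consecutive
terms.  `cfQ [m₁,…,m_k]` is the continued fraction `1/(m₁+1/(m₂+⋯+1/m_k))`.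
`memI1 M n s` / `memI2 M n s` express `s ∈ I₁(r;n)` / `s ∈ I₂(r;n)` where
`r = cfQ M`, and `memI1hat` / `memI2hat` express `s ∈ I₁(r)` / `s ∈ I₂(r)`.
The Heckoid group `Heck(r;n) = ⟨a,b | u_r^n⟩` is the quotient of `F` by the
normal closure `heckN r n` of `u_r^n`, with quotient map `heckQ r n`. -/

namespace Heckoid

/-- The position in `u_s` at which the `j`-th maximal constant-sign run starts. -/
def runStart (s : ℚ) (j : ℕ) : ℕ := ⌈(j : ℚ) / s⌉₊

theorem map_range_eq_flatten_replicate {α : Type*} (f : ℕ → ℕ) (h v : ℕ → α) (n : ℕ)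
    (hf : Monotone f) (h0 : f 0 = 0) (hv : ∀ j i, f j ≤ i → i < f (j + 1) → h i = v j) :
    (List.range (f n)).map h =
      ((List.range n).map fun j => List.replicate (f (j + 1) - f j) (v j)).flatten := by
  induction n with
  | zero => simp [h0]
  | succ n ih =>
    obtain ⟨d, hd⟩ := Nat.exists_eq_add_of_le (hf n.le_succ)
    rw [Nat.succ_eq_add_one] at hd
    rw [List.range_succ, List.map_append, List.flatten_append, ← ih, hd, List.range_add,
      List.map_append]
    simp only [List.map_map, List.map_cons, List.map_nil, List.flatten_cons, List.flatten_nil,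
      List.append_nil, hd, Nat.add_sub_cancel_left]
    congr 1
    refine List.eq_replicate_iff.2 ⟨by simp, fun b hb => ?_⟩
    obtain ⟨i, hi, rfl⟩ := List.mem_map.1 hb
    exact hv n _ (by simp) (by simp at hi ⊢; omega)

theorem runLengths_flatten_replicate {α : Type} [BEq α] [LawfulBEq α] (c : ℕ → ℕ) (v : ℕ → α)
    (n : ℕ) (hc : ∀ j, 0 < c j) (hv : ∀ j, v j ≠ v (j + 1)) :
    runLengths ((List.range n).map fun j => List.replicate (c j) (v j)).flatten =
      (List.range n).map c := by
  unfold runLengths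
  rw [List.splitBy_flatten, List.map_map]
  · simp [Function.comp_def]
  · simp only [List.mem_map, not_exists, not_and]
    intro j _ h
    have := congrArg List.length h
    simp at this
    exact (hc j).ne' this
  · simp only [List.mem_map]
    rintro _ ⟨j, _, rfl⟩
    exact List.isChain_replicate_of_rel _ (by simp)
  · rw [List.isChain_map, List.isChain_range]
    intro j _
    refine ⟨by simpa using (hc j).ne', by simpa using (hc _).ne', ?_⟩
    simpa using hv j

section RunStart

variable {s : ℚ}

theorem runStart_zero : runStart s 0 = 0 := by simp [runStart]

theorem runStart_mono (hs : 0 < s) : Monotone (runStart s) := by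
  intro i j hij
  unfold runStart
  gcongr

theorem le_runStart (j : ℕ) : (j : ℚ) / s ≤ runStart s j := Nat.le_ceil _

theorem runStart_lt (hs : 0 < s) (j : ℕ) : (runStart s j : ℚ) < j / s + 1 :=
  Nat.ceil_lt_add_one (by positivity)

theorem runStart_lt_succ (hs : 0 < s) (hs1 : s ≤ 1) (j : ℕ) :
    runStart s j < runStart s (j + 1) := by
  have h1 := runStart_lt hs j
  have h2 := le_runStart (s := s) (j + 1)
  have h3 : (1 : ℚ) ≤ 1 / s := by rwa [le_div_iff₀ hs, one_mul]
  push_cast at h2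
  rw [add_div] at h2
  exact_mod_cast (by linarith : (runStart s j : ℚ) < runStart s (j + 1))

theorem runStart_add_mul_num (hs : 0 < s) (j k : ℕ) :
    runStart s (j + k * s.num.toNat) = runStart s j + k * s.den := by
  have hnum : ((s.num.toNat : ℕ) : ℚ) = s * s.den := by
    rw [Rat.mul_den_eq_num]
    exact_mod_cast Int.toNat_of_nonneg (Rat.num_pos.2 hs).le
  unfold runStart
  rw [← Nat.ceil_add_natCast (by positivity)]
  congr 1
  push_cast
  rw [hnum]
  field_simp

theorem runStart_num (hs : 0 < s) : runStart s s.num.toNat = s.den := by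
  simpa [runStart_zero] using runStart_add_mul_num hs 0 1

theorem floor_mul_eq_of_runStart (hs : 0 < s) {i j : ℕ} (h1 : runStart s j ≤ i)
    (h2 : i < runStart s (j + 1)) : ⌊(i : ℚ) * s⌋.toNat = j := by
  rw [runStart, Nat.ceil_le, div_le_iff₀ hs] at h1
  rw [runStart, Nat.lt_ceil, lt_div_iff₀ hs] at h2
  have : ⌊(i : ℚ) * s⌋ = (j : ℤ) := Int.floor_eq_iff.2 ⟨by simpa using h1, by simpa using h2⟩
  simp [this]

theorem signList_eq (s : ℚ) :
    signList s = (List.range (2 * s.den)).map fun i : ℕ => (-1 : ℤ) ^ ⌊(i : ℚ) * s⌋.toNat := by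
  simp [signList, ← List.map_eq_flatMap]

theorem CS_eq (hs : 0 < s) (hs1 : s ≤ 1) :
    CS s = (List.range (2 * s.num.toNat)).map fun j => runStart s (j + 1) - runStart s j := by
  have hlen : 2 * s.den = runStart s (2 * s.num.toNat) := by
    simpa [runStart_zero] using (runStart_add_mul_num hs 0 2).symm
  rw [CS, signList_eq, hlen, map_range_eq_flatten_replicate (runStart s) _ (fun j => (-1 : ℤ) ^ j)
    _ (runStart_mono hs) runStart_zero, runLengths_flatten_replicate]
  · intro j
    exact Nat.sub_pos_of_lt (runStart_lt_succ hs hs1 j)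
  · intro j h
    rw [pow_succ] at h
    have : (-1 : ℤ) ^ j ≠ 0 := by positivity
    omega
  · intro j i h1 h2
    rw [floor_mul_eq_of_runStart hs h1 h2]

theorem runStart_succ_sub_mod (hs : 0 < s) (j : ℕ) :
    runStart s (j % (2 * s.num.toNat) + 1) - runStart s (j % (2 * s.num.toNat)) =
      runStart s (j + 1) - runStart s j := by
  have key (i : ℕ) := runStart_add_mul_num hs i (2 * (j / (2 * s.num.toNat)))
  have hj := Nat.mod_add_div j (2 * s.num.toNat)
  have h1 := key (j % (2 * s.num.toNat))
  have h2 := key (j % (2 * s.num.toNat) + 1)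
  rw [show j % (2 * s.num.toNat) + 2 * (j / (2 * s.num.toNat)) * s.num.toNat = j by
    nlinarith] at h1
  rw [show j % (2 * s.num.toNat) + 1 + 2 * (j / (2 * s.num.toNat)) * s.num.toNat = j + 1 by
    nlinarith] at h2
  omega

theorem runStart_add_length (hs : 0 < s) (hs1 : s ≤ 1) {T : List ℕ} {k : ℕ}
    (hT : T <+: (CS s).rotate k) : runStart s (k + T.length) = runStart s k + T.sum := by
  have hget (t : ℕ) (ht : t < T.length) :
      T[t] = runStart s (k + t + 1) - runStart s (k + t) := by
    rw [hT.getElem ht, List.getElem_rotate]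
    simp only [CS_eq hs hs1, List.getElem_map, List.getElem_range, List.length_map,
      List.length_range]
    rw [runStart_succ_sub_mod hs, add_comm t k]
  have htake (t : ℕ) (ht : t ≤ T.length) :
      runStart s (k + t) = runStart s k + (T.take t).sum := by
    induction t with
    | zero => simp
    | succ t ih =>
      have := ih (by omega)
      have hlt := runStart_mono hs (Nat.le_succ (k + t))
      rw [List.sum_take_succ _ _ ht, hget, ← add_assoc, ← add_assoc]
      simp only [Nat.succ_eq_add_one] at hlt
      omega
  simpa using htake T.length le_rfl

theorem sum_lt_of_cyclicContains (hs : 0 < s) (hs1 : s ≤ 1) {T : List ℕ}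
    (hT : CyclicContains (CS s) T) : ((T.sum : ℕ) : ℚ) < T.length / s + 1 := by
  obtain ⟨k, hk⟩ := hT
  have h := runStart_add_length hs hs1 hk
  have h1 := runStart_lt hs (k + T.length)
  have h2 := le_runStart (s := s) k
  rw [h, Nat.cast_add, Nat.cast_add, add_div] at h1
  linarith

theorem lt_sum_of_cyclicContains (hs : 0 < s) (hs1 : s ≤ 1) {T : List ℕ}
    (hT : CyclicContains (CS s) T) : (T.length : ℚ) / s < T.sum + 1 := by
  obtain ⟨k, hk⟩ := hT
  have h := runStart_add_length hs hs1 hk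
  have h1 := runStart_lt hs k
  have h2 := le_runStart (s := s) (k + T.length)
  rw [h, Nat.cast_add, Nat.cast_add, add_div] at h2
  linarith

/-- If `CS r = (S₁, S₂, S₁, S₂)` with `S₁`, `S₂` palindromic, then reversing a period of `CS r`
is the same as rotating it by the length of `S₁`. -/
theorem runStart_add_of_palindromes (hs : 0 < s) (hs1 : s ≤ 1) {S1 S2 : List ℕ}
    (hdec : CS s = S1 ++ S2 ++ S1 ++ S2) (h1 : S1.reverse = S1) (h2 : S2.reverse = S2)
    {i j : ℕ} (hij : i + j = s.num.toNat) :
    runStart s (S1.length + i) + runStart s j = runStart s S1.length + s.den := by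
  have hlen : S1.length + S2.length = s.num.toNat := by
    have := congrArg List.length (CS_eq hs hs1)
    rw [hdec] at this
    simp at this
    omega
  have hrot : S2 ++ S1 <+: (CS s).rotate S1.length := by
    rw [hdec, List.append_assoc, List.append_assoc, List.rotate_append_length_eq]
    simp
  have hpre : S1 ++ S2 <+: (CS s).rotate 0 := by
    rw [hdec, List.rotate_zero, List.append_assoc]
    exact List.prefix_append _ _
  have hA := runStart_add_length hs hs1 ((List.take_prefix i _).trans hrot)
  have hB := runStart_add_length hs hs1 ((List.take_prefix j _).trans hpre)
  have hC := runStart_add_length hs hs1 hpre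
  have hrev : (S2 ++ S1).take i = ((S1 ++ S2).drop j).reverse := by
    rw [List.reverse_drop, List.reverse_append, h1, h2, List.length_append]
    congr 1
    omega
  have hsum : ((S1 ++ S2).take j).sum + ((S1 ++ S2).drop j).sum = (S1 ++ S2).sum :=
    List.sum_take_add_sum_drop _ _
  rw [List.length_take, List.length_append, min_eq_left (by omega), hrev, List.sum_reverse] at hA
  rw [List.length_take, List.length_append, min_eq_left (by omega), zero_add,
    runStart_zero] at hB
  rw [List.length_append, hlen, zero_add, runStart_zero, runStart_num hs] at hC
  omega

end RunStart

/-- Let `a / b` and `c / d` be Farey neighbours with mediant `r`. If `CS r = (S₁, S₂, S₁, S₂)` with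
`S₁`, `S₂` palindromic, then their lengths are `a`, `c` and their sums are `b + 1`, `d - 1`. -/
theorem length_sum_of_palindromes {a b c d : ℕ} {r : ℚ} (ha : 0 < a) (hc : 0 < c)
    (hdet : a * d = c * b + 1) (hr : r = ((a + c : ℕ) : ℚ) / ((b + d : ℕ) : ℚ)) (hr1 : r ≤ 1)
    {S1 S2 : List ℕ} (hdec : CS r = S1 ++ S2 ++ S1 ++ S2) (hS1 : S1 ≠ []) (hS2 : S2 ≠ [])
    (hS1pal : S1.reverse = S1) (hS2pal : S2.reverse = S2) :
    S1.length = a ∧ S1.sum = b + 1 ∧ S2.length = c ∧ S2.sum + 1 = d := by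
  have hd : 0 < d := Nat.pos_of_mul_pos_left (a := a) (by omega)
  have hr0 : 0 < r := by rw [hr]; positivity
  have hcop : IsCoprime ((a + c : ℕ) : ℤ) ((b + d : ℕ) : ℤ) := by
    refine ⟨-b, a, ?_⟩
    push_cast
    linear_combination (by exact_mod_cast hdet : (a : ℤ) * d = c * b + 1)
  have hnum : r.num.toNat = a + c := by
    have := Rat.num_div_eq_of_coprime (a := ((a + c : ℕ) : ℤ)) (b := ((b + d : ℕ) : ℤ))
      (by positivity) (Int.isCoprime_iff_gcd_eq_one.1 hcop)
    rw [Int.cast_natCast, Int.cast_natCast, ← hr] at this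
    omega
  have hden : r.den = b + d := by
    have := Rat.den_div_eq_of_coprime (a := ((a + c : ℕ) : ℤ)) (b := ((b + d : ℕ) : ℤ))
      (by positivity) (Int.isCoprime_iff_gcd_eq_one.1 hcop)
    rw [Int.cast_natCast, Int.cast_natCast, ← hr] at this
    omega
  have hlow (j : ℕ) : j * (b + d) ≤ (a + c) * runStart r j := by
    have h := le_runStart (s := r) j
    generalize runStart r j = w at h ⊢
    rw [div_le_iff₀ hr0, hr, mul_div_assoc', le_div_iff₀ (by positivity)] at h
    rw [mul_comm (a + c)]
    exact_mod_cast h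
  have hupp (j : ℕ) : (a + c) * runStart r j < j * (b + d) + (a + c) := by
    have h := runStart_lt hr0 j
    generalize runStart r j = w at h ⊢
    rw [← sub_lt_iff_lt_add, lt_div_iff₀ hr0, hr, mul_div_assoc', div_lt_iff₀ (by positivity)] at h
    have h' : (((a + c) * w : ℕ) : ℚ) < ((j * (b + d) + (a + c) : ℕ) : ℚ) := by
      push_cast at h ⊢
      linarith
    exact_mod_cast h'
  have hlen : S1.length + S2.length = a + c := by
    have := congrArg List.length (CS_eq hr0 hr1)
    rw [hdec, hnum] at this
    simp at this
    omega
  have hstart : runStart r a = b + 1 := by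
    have h1 := hlow a
    have h2 := hupp a
    have h3 : b < runStart r a := by by_contra! h; nlinarith
    have h4 : runStart r a < b + 2 := by by_contra! h; nlinarith
    omega
  have hpal := runStart_add_of_palindromes hr0 hr1 hdec hS1pal hS2pal (i := c) (j := a)
    (by rw [hnum, add_comm])
  rw [hstart, hden] at hpal
  have hS1l := List.length_pos_iff.2 hS1
  have hS2l := List.length_pos_iff.2 hS2
  have hS1len : S1.length = a := by
    have h1 := hupp S1.length
    have h2 := hlow (S1.length + c)
    zify at h1 h2 hpal hdet hlen hS1l hS2l ha hc ⊢
    have hval : ((a : ℤ) + c) * runStart r S1.length = S1.length * (b + d) + (a + c) - 1 := by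
      have : (runStart r (S1.length + c) : ℤ) = runStart r S1.length + d - 1 := by linarith
      rw [this] at h2
      linarith
    have hdvd : ((a + c : ℕ) : ℤ) ∣ S1.length - a := by
      refine hcop.dvd_of_dvd_mul_right ⟨runStart r S1.length - 1 - b, ?_⟩
      push_cast
      linear_combination -hval - hdet
    have := Int.eq_zero_of_abs_lt_dvd hdvd (by rw [abs_lt]; push_cast; constructor <;> linarith)
    linarith
  have hsum1 := runStart_add_length hr0 hr1 (T := S1) (k := 0) (by simp [hdec])
  have hsum := runStart_add_length hr0 hr1 (T := S1 ++ S2) (k := 0)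
    (by rw [hdec, List.rotate_zero, List.append_assoc]; exact List.prefix_append _ _)
  rw [zero_add, runStart_zero, hS1len, hstart] at hsum1
  rw [zero_add, runStart_zero, List.length_append, hlen, ← hnum, runStart_num hr0, hden,
    List.sum_append] at hsum
  omega

theorem not_cyclicContains_of_farey {a b c d : ℕ} {r s : ℚ} (ha : 0 < a) (hc : 0 < c)
    (hdet : a * d = c * b + 1) (hr : r = ((a + c : ℕ) : ℚ) / ((b + d : ℕ) : ℚ)) (hr1 : r ≤ 1)
    {S1 S2 : List ℕ} (hdec : CS r = S1 ++ S2 ++ S1 ++ S2) (hS1 : S1 ≠ []) (hS2 : S2 ≠ [])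
    (hS1pal : S1.reverse = S1) (hS2pal : S2.reverse = S2) (hs0 : 0 < s) (hs1 : s ≤ 1)
    (hs : s * d ≤ c ∨ a ≤ s * b) :
    ¬ CyclicContains (CS s) S1 ∨ ¬ CyclicContains (CS s) S2 := by
  obtain ⟨hl1, hsum1, hl2, hsum2⟩ :=
    length_sum_of_palindromes ha hc hdet hr hr1 hdec hS1 hS2 hS1pal hS2pal
  rcases hs with hs | hs
  · refine Or.inr fun h => ?_
    have := lt_sum_of_cyclicContains hs0 hs1 h
    rw [div_lt_iff₀ hs0, hl2, ← Nat.cast_add_one, hsum2] at this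
    linarith
  · refine Or.inl fun h => ?_
    have := sum_lt_of_cyclicContains hs0 hs1 h
    rw [hl1, hsum1, Nat.cast_add_one, add_lt_add_iff_right, lt_div_iff₀ hs0] at this
    linarith

theorem CyclicContains.head?_eq {x : ℕ} {T : List ℕ} (h : CyclicContains [x] T) (hT : T ≠ []) :
    T.head? = some x := by
  obtain ⟨k, u, hu⟩ := h
  rw [List.rotate_singleton] at hu
  cases T with
  | nil => exact absurd rfl hT
  | cons y T => simp_all

theorem CS_zero : CS 0 = [2] := by
  simp [CS, signList_eq, runLengths, List.range_succ, List.splitBy, List.splitBy.loop]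

/-- `[m₁, …, m_{k-1}]` and `[m₁, …, m_{k-1}, m_k - 1]` are Farey neighbours with mediant
`[m₁, …, m_k]`. -/
theorem exists_cfQ_eq_div (L : List ℕ) (hL : ∀ x ∈ L, 0 < x) (t : ℕ) (ht : 2 ≤ t) :
    ∃ a b c d : ℕ, cfQ L = (a : ℚ) / b ∧ cfQ (L ++ [t - 1]) = (c : ℚ) / d ∧
      cfQ (L ++ [t]) = ((a + c : ℕ) : ℚ) / ((b + d : ℕ) : ℚ) ∧
      0 < b ∧ a ≤ b ∧ 0 < c ∧ c ≤ d ∧ (L ≠ [] → 0 < a) ∧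
      if Even L.length then c * b = a * d + 1 else a * d = c * b + 1 := by
  induction L with
  | nil =>
    refine ⟨0, 1, 1, t - 1, by simp [cfQ], by simp [cfQ], ?_, by simp, by simp, by simp, by omega,
      by simp, by simp⟩
    rw [show 1 + (t - 1) = t by omega]
    simp [cfQ]
  | cons x L ih =>
    obtain ⟨a, b, c, d, h1, h2, h3, hb, hab, hc, hcd, -, hdet⟩ :=
      ih fun y hy => hL y (List.mem_cons_of_mem _ hy)
    have hx : 0 < x := hL x (by simp)
    have hd : 0 < d := by omega
    refine ⟨b, x * b + a, d, x * d + c, ?_, ?_, ?_, by positivity, by nlinarith, hd, by nlinarith,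
      fun _ => hb, ?_⟩
    · rw [cfQ, h1]
      field_simp
      push_cast
      ring
    · rw [List.cons_append, cfQ, h2]
      field_simp
      push_cast
      ring
    · rw [List.cons_append, cfQ, h3]
      field_simp
      push_cast
      ring
    · rw [List.length_cons]
      split_ifs at hdet ⊢ with h h' h' <;> first | (rw [Nat.even_add_one] at h; tauto) | nlinarith

/-- Lemma 2.3: for `s ∈ I₁(r) ∪ I₂(r)`, at least one of `S₁`, `S₂` does not
occur in `CS(s)` as a subsequence. -/
theorem statement4
    (M : List ℕ) (m n : ℕ) (r : ℚ)
    (hMlen : 2 ≤ M.length) (hMpos : ∀ x ∈ M, 0 < x) (hMlast : 2 ≤ M.getLast!)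
    (hm : M.head? = some m) (hn : 2 ≤ n) (hr : r = cfQ M)
    (S1 S2 : List ℕ) (hdec : CS r = S1 ++ S2 ++ S1 ++ S2)
    (hS1ne : S1 ≠ []) (hS2ne : S2 ≠ [])
    (hS1pal : S1.reverse = S1) (hS2pal : S2.reverse = S2)
    (hS1h : S1.head? = some (m + 1)) (hS2h : S2.head? = some m)
    (s : ℚ) (hs : memI1hat M s ∨ memI2hat M s) :
    ¬ CyclicContains (CS s) S1 ∨ ¬ CyclicContains (CS s) S2 := by
  obtain ⟨L, t, rfl⟩ : ∃ L t, M = L ++ [t] :=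
    ⟨_, _, (List.dropLast_append_getLast (List.ne_nil_of_length_pos (by omega))).symm⟩
  have hlast : (L ++ [t]).getLast! = t := by simp [List.getLast!_eq_getLast?_getD]
  rw [hlast] at hMlast
  simp only [memI1hat, memI2hat, hlast, List.dropLast_concat, List.length_append,
    List.length_singleton, Nat.even_add_one] at hs
  have hLne : L ≠ [] := by
    rintro rfl
    simp at hMlen
  obtain ⟨a, b, c, d, h1, h2, h3, hb, hab, hc, hcd, ha, hdet⟩ :=
    exists_cfQ_eq_div L (fun x hx => hMpos x (by simp [hx])) t hMlast
  have ha := ha hLne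
  have hd : 0 < d := by omega
  have hr1 : r ≤ 1 := by
    rw [hr, h3]
    exact div_le_one_of_le₀ (by exact_mod_cast add_le_add hab hcd) (by positivity)
  have hab1 : (a : ℚ) / b ≤ 1 := div_le_one_of_le₀ (by exact_mod_cast hab) (by positivity)
  have hcd1 : (c : ℚ) / d ≤ 1 := div_le_one_of_le₀ (by exact_mod_cast hcd) (by positivity)
  have hab0 : 0 ≤ (a : ℚ) / b := by positivity
  have hcd0 : 0 ≤ (c : ℚ) / d := by positivity
  have hs0 : 0 ≤ s := by
    rw [h1, h2] at hs
    split_ifs at hs <;> rcases hs with hs | hs <;> linarith [hs.1]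
  have hs1 : s ≤ 1 := by
    rw [h1, h2] at hs
    split_ifs at hs <;> rcases hs with hs | hs <;> linarith [hs.2]
  rcases hs0.eq_or_lt with rfl | hs0
  · by_contra! h
    rw [CS_zero] at h
    have e1 := h.1.head?_eq hS1ne
    have e2 := h.2.head?_eq hS2ne
    simp_all
  rw [h3] at hr
  rw [h1, h2] at hs
  by_cases hL : Even L.length
  · simp only [hL, not_true_eq_false, if_true, if_false] at hs hdet
    refine not_cyclicContains_of_farey hc ha hdet (by rw [hr, add_comm a, add_comm b]) hr1 hdec
      hS1ne hS2ne hS1pal hS2pal hs0 hs1 ?_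
    refine hs.imp (fun h => ?_) (fun h => ?_)
    · exact (le_div_iff₀ (by positivity)).1 h.2
    · exact (div_le_iff₀ (by positivity)).1 h.1
  · simp only [hL, not_false_eq_true, if_true, if_false] at hs hdet
    refine not_cyclicContains_of_farey ha hc hdet hr hr1 hdec
      hS1ne hS2ne hS1pal hS2pal hs0 hs1 ?_
    refine hs.imp (fun h => ?_) (fun h => ?_)
    · exact (le_div_iff₀ (by positivity)).1 h.2
    · exact (div_le_iff₀ (by positivity)).1 h.1

end Heckoid
end
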